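/- arXiv:1201.5995 — 3 statements merged into one kernel-verified Lean document; each statement's English description precedes it below -/
import Mathlib

section
/- The subspace of (ℂ^n)^{⊗3} spanned by all tensors of the form φ̄ ⊗ φ ⊗ ψ with φ, ψ ∈ ℂ^n, ‖φ‖ = 1, and ⟨φ, ψ⟩ = 0, equals T_{13} = {Ψ : Σ_i Ψ_{iji} = 0 for all j}. -/
open ComplexConjugate

/-- `T_{13}`: tensors with `Σ_i Ψ_{iji} = 0` for all `j`. -/
noncomputable def T13 (n : ℕ) : Submodule ℂ (Fin n × Fin n × Fin n → ℂ) where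
  carrier := {Ψ | ∀ j : Fin n, (∑ i : Fin n, Ψ (i, j, i)) = 0}
  add_mem' := by
    intro a b ha hb j
    simpa [Finset.sum_add_distrib] using by rw [ha j, hb j]; ring
  zero_mem' := by intro j; simp
  smul_mem' := by
    intro c Ψ hΨ j
    simp [← Finset.mul_sum, hΨ j]

/-- The span in question. -/
noncomputable def genSpan (n : ℕ) : Submodule ℂ (Fin n × Fin n × Fin n → ℂ) :=
  Submodule.span ℂ
      {Ψ : Fin n × Fin n × Fin n → ℂ | ∃ φ ψ : Fin n → ℂ,
        (∑ i : Fin n, conj (φ i) * φ i) = 1 ∧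
        (∑ i : Fin n, conj (φ i) * ψ i) = 0 ∧
        Ψ = fun p => conj (φ p.1) * φ p.2.1 * ψ p.2.2}

/-- The normalization of `φ` can be dropped. -/
lemma mem_genSpan {n : ℕ} (φ ψ : Fin n → ℂ) (h : (∑ i : Fin n, conj (φ i) * ψ i) = 0) :
    (fun p : Fin n × Fin n × Fin n => conj (φ p.1) * φ p.2.1 * ψ p.2.2) ∈ genSpan n := by
  by_cases h0 : φ = 0
  · subst h0
    convert (genSpan n).zero_mem using 1
    ext p
    simp
  have hs : (∑ i : Fin n, conj (φ i) * φ i) = ((∑ i, Complex.normSq (φ i) : ℝ) : ℂ) := by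
    push_cast
    exact Finset.sum_congr rfl fun i _ => (Complex.normSq_eq_conj_mul_self).symm
  set N : ℝ := ∑ i, Complex.normSq (φ i) with hN
  have hpos : 0 < N := by
    obtain ⟨i, hi⟩ := Function.ne_iff.mp h0
    exact Finset.sum_pos' (fun i _ => Complex.normSq_nonneg _)
      ⟨i, Finset.mem_univ _, Complex.normSq_pos.mpr hi⟩
  set r : ℝ := Real.sqrt N with hr
  have hr0 : (r : ℂ) ≠ 0 := by
    exact_mod_cast (Real.sqrt_pos.mpr hpos).ne'
  have hr2 : (r : ℂ) * r = N := by
    exact_mod_cast Real.mul_self_sqrt hpos.le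
  have hg : (fun p : Fin n × Fin n × Fin n =>
      conj ((r : ℂ)⁻¹ * φ p.1) * ((r : ℂ)⁻¹ * φ p.2.1) * ψ p.2.2) ∈ genSpan n := by
    apply Submodule.subset_span
    refine ⟨fun i => (r : ℂ)⁻¹ * φ i, ψ, ?_, ?_, rfl⟩
    · have : ∀ i, conj ((r : ℂ)⁻¹ * φ i) * ((r : ℂ)⁻¹ * φ i)
          = ((r : ℂ)⁻¹ * (r : ℂ)⁻¹) * (conj (φ i) * φ i) := by
        intro i; simp; ring
      simp only [this]
      rw [← Finset.mul_sum, hs, ← hr2]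
      field_simp
    · have : ∀ i, conj ((r : ℂ)⁻¹ * φ i) * ψ i = (r : ℂ)⁻¹ * (conj (φ i) * ψ i) := by
        intro i; simp; ring
      simp only [this]
      rw [← Finset.mul_sum, h, mul_zero]
  convert (genSpan n).smul_mem ((r : ℂ) * r) hg using 1
  ext p
  simp
  field_simp

/-- A vector orthogonal to `y` (bilinearly), linear in `y`. -/
def perp {n : ℕ} (k l : Fin n) (y : Fin n → ℂ) : Fin n → ℂ :=
  fun i => y l * (Pi.single k 1 : Fin n → ℂ) i - y k * (Pi.single l 1 : Fin n → ℂ) i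

lemma sum_perp {n : ℕ} (k l : Fin n) (y : Fin n → ℂ) : ∑ i, y i * perp k l y i = 0 := by
  simp [perp, Pi.single_apply, mul_sub, Finset.sum_sub_distrib]
  ring

lemma polar_mem {n : ℕ} (k l : Fin n) (w e : Fin n → ℂ) (hw : ∀ i, conj (w i) = w i)
    (he : ∀ i, conj (e i) = e i) :
    (fun p : Fin n × Fin n × Fin n => w p.1 * e p.2.1 * perp k l w p.2.2) ∈ genSpan n := by
  have key : ∀ t : ℂ, (fun p : Fin n × Fin n × Fin n =>
      (w p.1 + conj t * e p.1) * (w p.2.1 + t * e p.2.1) *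
        (perp k l w p.2.2 + conj t * perp k l e p.2.2)) ∈ genSpan n := by
    intro t
    have hp : ∀ i, perp k l w i + conj t * perp k l e i
        = perp k l (fun i => w i + conj t * e i) i := by
      intro i; simp only [perp]; ring
    have hc : ∀ i, conj (w i + t * e i) = w i + conj t * e i := by
      intro i; simp [hw, he]
    have := mem_genSpan (fun i => w i + t * e i) (perp k l (fun i => w i + conj t * e i))
      (by simp only [hc]; exact sum_perp k l _)
    simp only [hc] at this
    simp only [hp]
    exact this
  have h := (genSpan n).smul_mem (1 / 4 : ℂ) ((genSpan n).add_mem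
    ((genSpan n).sub_mem (key 1) (key (-1)))
    ((genSpan n).smul_mem Complex.I ((genSpan n).sub_mem (key (-Complex.I)) (key Complex.I))))
  convert h using 1
  ext p
  simp
  have hI := Complex.I_sq
  have hI4 : Complex.I ^ 4 = 1 := Complex.I_pow_four
  ring_nf
  simp only [hI, hI4]
  ring

lemma single_triple {n : ℕ} (i j k : Fin n) (p : Fin n × Fin n × Fin n) :
    (Pi.single (i, j, k) 1 : Fin n × Fin n × Fin n → ℂ) p =
    (Pi.single i 1 : Fin n → ℂ) p.1 * (Pi.single j 1 : Fin n → ℂ) p.2.1 *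
      (Pi.single k 1 : Fin n → ℂ) p.2.2 := by
  obtain ⟨a, b, c⟩ := p
  by_cases h1 : a = i <;> by_cases h2 : b = j <;> by_cases h3 : c = k <;>
    simp [h1, h2, h3]

lemma conj_single {n : ℕ} (j i : Fin n) :
    conj ((Pi.single j 1 : Fin n → ℂ) i) = (Pi.single j 1 : Fin n → ℂ) i := by
  by_cases h : i = j <;> simp [h]

lemma off_mem {n : ℕ} (i j k : Fin n) (h : i ≠ k) :
    (Pi.single (i, j, k) 1 : Fin n × Fin n × Fin n → ℂ) ∈ genSpan n := by
  convert polar_mem k i (Pi.single i 1) (Pi.single j 1) (conj_single i) (conj_single j) using 1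
  ext p
  rw [single_triple]
  simp [perp, h.symm]

lemma diag_mem {n : ℕ} (l j k : Fin n) :
    (Pi.single (k, j, k) 1 - Pi.single (l, j, l) 1 : Fin n × Fin n × Fin n → ℂ)
      ∈ genSpan n := by
  by_cases h : l = k
  · subst h; simp
  have h1 := polar_mem k l (Pi.single l 1 + Pi.single k 1) (Pi.single j 1)
    (by intro i; simp only [Pi.add_apply, map_add, conj_single]) (conj_single j)
  have h2 := (genSpan n).add_mem ((genSpan n).sub_mem h1 (off_mem l j k h))
    (off_mem k j l (Ne.symm h))
  convert h2 using 1
  ext p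
  simp only [Pi.add_apply, Pi.sub_apply, single_triple, perp, Pi.single_eq_same,
    Pi.single_eq_of_ne h, Pi.single_eq_of_ne (Ne.symm h)]
  ring

/-- The span of the tensors `φ̄ ⊗ φ ⊗ ψ` with `‖φ‖ = 1` and `φ ⊥ ψ`
equals `T_{13}`. -/
theorem span_phibar_phi_psi_eq_T13 (n : ℕ) :
    Submodule.span ℂ
      {Ψ : Fin n × Fin n × Fin n → ℂ | ∃ φ ψ : Fin n → ℂ,
        (∑ i : Fin n, conj (φ i) * φ i) = 1 ∧
        (∑ i : Fin n, conj (φ i) * ψ i) = 0 ∧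
        Ψ = fun p => conj (φ p.1) * φ p.2.1 * ψ p.2.2} = T13 n := by
  change genSpan n = T13 n
  apply le_antisymm
  · apply Submodule.span_le.mpr
    rintro _ ⟨φ, ψ, -, h, rfl⟩ j
    have : ∀ i, conj (φ i) * φ j * ψ i = φ j * (conj (φ i) * ψ i) := by intro i; ring
    simp only [this]
    rw [← Finset.mul_sum, h, mul_zero]
  · intro Ψ hΨ
    have hΨ' : ∀ j : Fin n, (∑ i : Fin n, Ψ (i, j, i)) = 0 := hΨ
    rw [← Submodule.ker_mkQ (genSpan n), LinearMap.mem_ker]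
    have hsum : Ψ = ∑ p, Ψ p • (Pi.single p 1 : Fin n × Fin n × Fin n → ℂ) := by
      ext q
      simp [Finset.sum_apply, Pi.single_apply]
    rcases isEmpty_or_nonempty (Fin n) with hE | ⟨⟨z⟩⟩
    · have : Ψ = 0 := by ext p; exact hE.elim p.1
      rw [this, map_zero]
    have hf : ∀ i j k : Fin n, (genSpan n).mkQ (Pi.single (i, j, k) 1)
        = if k = i then (genSpan n).mkQ (Pi.single (z, j, z) 1) else 0 := by
      intro i j k
      split_ifs with h
      · subst h
        rw [← sub_eq_zero, ← map_sub, ← LinearMap.mem_ker, Submodule.ker_mkQ]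
        exact diag_mem z j k
      · rw [← LinearMap.mem_ker, Submodule.ker_mkQ]
        exact off_mem i j k (Ne.symm h)
    generalize hg : (fun j : Fin n => (genSpan n).mkQ (Pi.single (z, j, z) 1)) = g
    have hf' : ∀ i j k : Fin n, (genSpan n).mkQ (Pi.single (i, j, k) 1)
        = if k = i then g j else 0 := by
      intro i j k
      rw [hf i j k, ← hg]
    rw [hsum, map_sum]
    simp only [map_smul, Fintype.sum_prod_type, hf', smul_ite, smul_zero, Finset.sum_ite_eq',
      Finset.mem_univ, if_true]
    rw [Finset.sum_comm]
    refine Finset.sum_eq_zero fun j _ => ?_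
    rw [← Finset.sum_smul, hΨ' j, zero_smul]
end

section
/- Let W = span{ x̄ ⊗ x ⊗ y : x = σ ⊗ φ with σ ∈ ℂ², φ ∈ ℂ^n, and Φ_n(|x⟩⟨x|) y = 0 } ⊂ (ℂ^{2n})^{⊗3}. Then dim W = 7n³ + n² − 2n, equivalently dim W^⊥ = n³ − n² + 2n. -/
open scoped ComplexOrder

/-- The reduction map `R_n(X) = (Tr X) • I - X` on `n × n` complex matrices. -/
noncomputable def Rmap (n : ℕ) (X : Matrix (Fin n) (Fin n) ℂ) :
    Matrix (Fin n) (Fin n) ℂ :=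
  X.trace • (1 : Matrix (Fin n) (Fin n) ℂ) - X

/-- The map `Φ_n` on `2n × 2n` complex matrices, written in block form. -/
noncomputable def Phi (n : ℕ)
    (X : Matrix (Fin n ⊕ Fin n) (Fin n ⊕ Fin n) ℂ) :
    Matrix (Fin n ⊕ Fin n) (Fin n ⊕ Fin n) ℂ :=
  ((n : ℂ)⁻¹) • Matrix.fromBlocks
    (X.toBlocks₂₂.trace • (1 : Matrix (Fin n) (Fin n) ℂ))
    (-(X.toBlocks₁₂) - Rmap n X.toBlocks₂₁)
    (-(X.toBlocks₂₁) - Rmap n X.toBlocks₁₂)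
    (X.toBlocks₁₁.trace • (1 : Matrix (Fin n) (Fin n) ℂ))

open ComplexConjugate

set_option linter.unusedSimpArgs false
set_option linter.unnecessarySeqFocus false

open Matrix Complex

structure TriLin {V E : Type*} [AddCommGroup V] [Module ℂ V] [AddCommGroup E] [Module ℂ E]
    (F : V → V → V → E) : Prop where
  add1 : ∀ x x' y z, F (x + x') y z = F x y z + F x' y z
  add2 : ∀ x y y' z, F x (y + y') z = F x y z + F x y' z
  add3 : ∀ x y z z', F x y (z + z') = F x y z + F x y z'
  smul1 : ∀ (c : ℂ) x y z, F (c • x) y z = c • F x y z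
  smul2 : ∀ (c : ℂ) x y z, F x (c • y) z = c • F x y z
  smul3 : ∀ (c : ℂ) x y z, F x y (c • z) = c • F x y z

section polar
variable {m : ℕ} {E : Type*} [AddCommGroup E] [Module ℂ E]

lemma polar_sym (F : (Fin m → ℂ) → (Fin m → ℂ) → (Fin m → ℂ) → E) (hF : TriLin F)
    (M : Submodule ℂ E) (h : ∀ x, F (star x) x x ∈ M) (x y z : Fin m → ℂ) :
    F x y z + F x z y ∈ M := by
  have key : ∀ u v, F (star v) u u ∈ M := by
    intro u v
    have h0 := h (u + (1 : ℂ) • v)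
    have h1 := h (u + I • v)
    have h2 := h (u + (-1 : ℂ) • v)
    have h3 := h (u + (-I) • v)
    have e : F (star v) u u = (1 / 4 : ℂ) • (F (star (u + (1 : ℂ) • v)) (u + (1 : ℂ) • v) (u + (1 : ℂ) • v)
        + I • F (star (u + I • v)) (u + I • v) (u + I • v)
        + (-1 : ℂ) • F (star (u + (-1 : ℂ) • v)) (u + (-1 : ℂ) • v) (u + (-1 : ℂ) • v)
        + (-I) • F (star (u + (-I) • v)) (u + (-I) • v) (u + (-I) • v)) := by
      simp only [star_add, star_smul, hF.add1, hF.add2, hF.add3, hF.smul1, hF.smul2, hF.smul3,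
        star_one, star_neg, Complex.star_def, Complex.conj_I]
      match_scalars <;> (ring_nf; try simp [Complex.I_sq, Complex.I_pow_three, Complex.I_pow_four]) <;> norm_num
    rw [e]
    exact M.smul_mem _ (M.add_mem (M.add_mem (M.add_mem h0 (M.smul_mem _ h1)) (M.smul_mem _ h2))
      (M.smul_mem _ h3))
  have key' : ∀ u, F x u u ∈ M := fun u => by simpa using key u (star x)
  have e : F x y z + F x z y = F x (y + z) (y + z) - F x y y - F x z z := by
    simp only [hF.add2, hF.add3]; abel
  rw [e]
  exact M.sub_mem (M.sub_mem (key' _) (key' _)) (key' _)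


lemma polar1 (G : (Fin m → ℂ) → (Fin m → ℂ) → (Fin m → ℂ) → E) (hG : TriLin G)
    (M : Submodule ℂ E) (h : ∀ x w, star x ⬝ᵥ w = 0 → G (star x) x w ∈ M)
    (p q w : Fin m → ℂ) (hp : star p ⬝ᵥ w = 0) (hq : star q ⬝ᵥ w = 0) :
    G (star q) p w ∈ M := by
  have hh : ∀ t : ℂ, G (star (p + t • q)) (p + t • q) w ∈ M := fun t => h _ _ (by
    simp [star_add, star_smul, add_dotProduct, smul_dotProduct, hp, hq])
  have e : G (star q) p w = (1 / 4 : ℂ) • (G (star (p + (1 : ℂ) • q)) (p + (1 : ℂ) • q) w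
        + I • G (star (p + I • q)) (p + I • q) w
        + (-1 : ℂ) • G (star (p + (-1 : ℂ) • q)) (p + (-1 : ℂ) • q) w
        + (-I) • G (star (p + (-I) • q)) (p + (-I) • q) w) := by
      simp only [star_add, star_smul, hG.add1, hG.add2, hG.add3, hG.smul1, hG.smul2, hG.smul3,
        star_one, star_neg, Complex.star_def, Complex.conj_I]
      match_scalars <;> (ring_nf; try simp [Complex.I_sq, Complex.I_pow_three, Complex.I_pow_four]) <;> norm_num
  rw [e]
  exact M.smul_mem _ (M.add_mem (M.add_mem (M.add_mem (hh _) (M.smul_mem _ (hh _))) (M.smul_mem _ (hh _)))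
      (M.smul_mem _ (hh _)))

lemma polar2 (G : (Fin m → ℂ) → (Fin m → ℂ) → (Fin m → ℂ) → E) (hG : TriLin G)
    (M : Submodule ℂ E) (h : ∀ x w, star x ⬝ᵥ w = 0 → G (star x) x w ∈ M)
    (q w : Fin m → ℂ) (hq : star q ⬝ᵥ w = 0) (hn : star q ⬝ᵥ q = star w ⬝ᵥ w) :
    G (star q) w w ∈ M := by
  have hq' : star w ⬝ᵥ q = 0 := by
    have := congrArg star hq
    rw [← star_dotProduct_star] at this
    simpa using this
  have hh : ∀ t : ℂ, G (star (q + t • w)) (q + t • w) (w + (-star t) • q) ∈ M := fun t => h _ _ (by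
    simp [star_add, star_smul, add_dotProduct, smul_dotProduct, dotProduct_add, dotProduct_smul, hq, hq', hn])
  have e : G (star q) w w = (1 / 4 : ℂ) • (
        G (star (q + (1 : ℂ) • w)) (q + (1 : ℂ) • w) (w + (-star (1 : ℂ)) • q)
        + (-I) • G (star (q + I • w)) (q + I • w) (w + (-star I) • q)
        + (-1 : ℂ) • G (star (q + (-1 : ℂ) • w)) (q + (-1 : ℂ) • w) (w + (-star (-1 : ℂ)) • q)
        + I • G (star (q + (-I) • w)) (q + (-I) • w) (w + (-star (-I)) • q)) := by
      simp only [star_add, star_smul, hG.add1, hG.add2, hG.add3, hG.smul1, hG.smul2, hG.smul3,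
        star_one, star_neg, Complex.star_def, Complex.conj_I]
      match_scalars <;> (ring_nf; try simp [Complex.I_sq, Complex.I_pow_three, Complex.I_pow_four]) <;> norm_num
  rw [e]
  exact M.smul_mem _ (M.add_mem (M.add_mem (M.add_mem (hh _) (M.smul_mem _ (hh _))) (M.smul_mem _ (hh _)))
      (M.smul_mem _ (hh _)))

lemma polar3 (G : (Fin m → ℂ) → (Fin m → ℂ) → (Fin m → ℂ) → E) (hG : TriLin G)
    (M : Submodule ℂ E) (h : ∀ x w, star x ⬝ᵥ w = 0 → G (star x) x w ∈ M)
    (p q w : Fin m → ℂ) (hq : star q ⬝ᵥ w = 0) (hn : star q ⬝ᵥ q = star w ⬝ᵥ w)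
    (hw : star w ⬝ᵥ w ≠ 0) : G (star q) p w ∈ M := by
  set c : ℂ := star ((star p ⬝ᵥ w) / (star w ⬝ᵥ w)) with hc
  have h1 := polar1 G hG M h (p + (-c) • w) q w (by
    simp only [star_add, star_smul, star_neg, hc, star_star, add_dotProduct, smul_dotProduct, smul_eq_mul]
    field_simp
    ring) hq
  have h2 := polar2 G hG M h q w hq hn
  have e : G (star q) p w = G (star q) (p + (-c) • w) w + c • G (star q) w w := by
    simp only [hG.add2, hG.smul2]; module
  rw [e]
  exact M.add_mem h1 (M.smul_mem _ h2)

lemma off_mem_s17 (G : (Fin m → ℂ) → (Fin m → ℂ) → (Fin m → ℂ) → E) (hG : TriLin G)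
    (M : Submodule ℂ E) (h : ∀ x w, star x ⬝ᵥ w = 0 → G (star x) x w ∈ M)
    (i j k : Fin m) (hik : i ≠ k) :
    G (Pi.single i 1) (Pi.single j 1) (Pi.single k 1) ∈ M := by
  have := polar3 G hG M h (Pi.single j 1) (Pi.single i 1) (Pi.single k 1)
    (by simp [← Pi.single_star, hik, hik.symm]) (by simp [← Pi.single_star]) (by simp [← Pi.single_star])
  simpa [← Pi.single_star] using this

lemma diag_mem_s17 (G : (Fin m → ℂ) → (Fin m → ℂ) → (Fin m → ℂ) → E) (hG : TriLin G)
    (M : Submodule ℂ E) (h : ∀ x w, star x ⬝ᵥ w = 0 → G (star x) x w ∈ M)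
    (l j k : Fin m) :
    G (Pi.single k 1) (Pi.single j 1) (Pi.single k 1)
      - G (Pi.single l 1) (Pi.single j 1) (Pi.single l 1) ∈ M := by
  by_cases hlk : k = l
  · subst hlk; simp
  have := polar3 G hG M h (Pi.single j 1) (Pi.single k 1 + (-1 : ℂ) • Pi.single l 1)
    (Pi.single k 1 + Pi.single l 1)
    (by simp [← Pi.single_star, add_dotProduct, hlk, Ne.symm hlk])
    (by simp [← Pi.single_star, add_dotProduct, hlk, Ne.symm hlk])
    (by simp [← Pi.single_star, add_dotProduct, hlk, Ne.symm hlk])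
  have h1 := off_mem_s17 G hG M h k j l hlk
  have h2 := off_mem_s17 G hG M h l j k (Ne.symm hlk)
  have e : star (Pi.single k 1 + (-1 : ℂ) • Pi.single l 1 : Fin m → ℂ)
    = Pi.single k 1 + (-1 : ℂ) • Pi.single l 1 := by simp [star_add, ← Pi.single_star]
  rw [e] at this
  simp only [hG.add1, hG.add3, hG.smul1] at this
  have := M.add_mem (M.sub_mem this h1) h2
  convert this using 1
  module

end polar

lemma traceless_sum {m : ℕ} {E : Type*} [AddCommGroup E] [Module ℂ E] (M : Submodule ℂ E)
    (D : Fin m → Fin m → Fin m → E) (l : Fin m)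
    (h1 : ∀ i j k, i ≠ k → D i j k ∈ M) (h2 : ∀ j k, D k j k - D l j l ∈ M)
    (X : Fin m → Fin m → Fin m → ℂ) (hX : ∀ j, ∑ i, X i j i = 0) :
    ∑ i, ∑ j, ∑ k, X i j k • D i j k ∈ M := by
  rw [Finset.sum_comm]
  refine M.sum_mem fun j _ => ?_
  have e : ∑ i, ∑ k, X i j k • D i j k
      = ∑ i, ∑ k, X i j k • (D i j k - if i = k then D l j l else 0) := by
    simp only [smul_sub, Finset.sum_sub_distrib, smul_ite, smul_zero, Finset.sum_ite_eq,
      Finset.mem_univ, if_true, ← Finset.sum_smul, hX, zero_smul, sub_zero]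
  rw [e]
  refine M.sum_mem fun i _ => M.sum_mem fun k _ => M.smul_mem _ ?_
  by_cases hik : i = k
  · subst hik; simpa using h2 j i
  · simpa [hik] using h1 i j k hik

lemma finrank_aux {I Q R : Type*} [Fintype I] [Fintype Q] [Fintype R] (q : I → Q)
    (hq : Function.Surjective q) (tr : (Q → ℂ) →ₗ[ℂ] (R → ℂ)) (htr : Function.Surjective tr)
    (U : Submodule ℂ (I → ℂ))
    (h1 : ∀ g : Q → ℂ, tr g = 0 → g ∘ q ∈ U)
    (h2 : ∀ f ∈ U, ∀ x y, q x = q y → f x = f y)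
    (h3 : ∀ g : Q → ℂ, g ∘ q ∈ U → tr g = 0) :
    Module.finrank ℂ U + Fintype.card R = Fintype.card Q := by
  have hU : U = (LinearMap.ker tr).map (LinearMap.funLeft ℂ ℂ q) := by
    ext f
    simp only [Submodule.mem_map, LinearMap.mem_ker]
    constructor
    · intro hf
      have e : (f ∘ Function.surjInv hq) ∘ q = f := by
        funext x
        exact h2 f hf _ _ (Function.surjInv_eq hq _)
      exact ⟨f ∘ Function.surjInv hq, h3 _ (by rw [e]; exact hf), e⟩
    · rintro ⟨g, hg, rfl⟩
      exact h1 g hg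
  have inj := LinearMap.funLeft_injective_of_surjective ℂ ℂ q hq
  rw [hU, ← (Submodule.equivMapOfInjective _ inj (LinearMap.ker tr)).finrank_eq]
  have := LinearMap.finrank_range_add_finrank_ker tr
  rw [LinearMap.range_eq_top.2 htr, finrank_top] at this
  simp only [Module.finrank_fintype_fun_eq_card] at this
  omega

abbrev Idx (n : ℕ) := (Fin 2 × Fin 2 × Fin 2) × (Fin n × Fin n × Fin n)

def TT {n : ℕ} (a b c : Fin 2 → ℂ) (x y z : Fin n → ℂ) : Idx n → ℂ := fun p =>
  (a p.1.1 * b p.1.2.1 * c p.1.2.2) * (x p.2.1 * y p.2.2.1 * z p.2.2.2)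

lemma TT_lin_left {n : ℕ} (x y z : Fin n → ℂ) : TriLin (fun a b c => TT a b c x y z) := by
  constructor <;> intros <;> funext p <;> simp [TT] <;> ring

lemma TT_lin_right {n : ℕ} (a b c : Fin 2 → ℂ) : TriLin (fun x y z : Fin n → ℂ => TT a b c x y z) := by
  constructor <;> intros <;> funext p <;> simp [TT] <;> ring

lemma TriLin.add {V E : Type*} [AddCommGroup V] [Module ℂ V] [AddCommGroup E] [Module ℂ E]
    {F G : V → V → V → E} (hF : TriLin F) (hG : TriLin G) :
    TriLin (fun x y z => F x y z + G x y z) := by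
  constructor <;> intros <;>
  simp only [hF.add1, hF.add2, hF.add3, hF.smul1, hF.smul2, hF.smul3,
    hG.add1, hG.add2, hG.add3, hG.smul1, hG.smul2, hG.smul3] <;> module

lemma TriLin.swap {V E : Type*} [AddCommGroup V] [Module ℂ V] [AddCommGroup E] [Module ℂ E]
    {F : V → V → V → E} (hF : TriLin F) :
    TriLin (fun x y z => F y x z) := by
  constructor <;> intros <;>
  simp only [hF.add1, hF.add2, hF.add3, hF.smul1, hF.smul2, hF.smul3]

lemma TT_single {n : ℕ} (p : Idx n) :
    TT (Pi.single p.1.1 1) (Pi.single p.1.2.1 1) (Pi.single p.1.2.2 1)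
      (Pi.single p.2.1 1) (Pi.single p.2.2.1 1) (Pi.single p.2.2.2 1) = Pi.single p 1 := by
  obtain ⟨⟨a, b, c⟩, ⟨i, j, k⟩⟩ := p
  funext ⟨⟨a', b', c'⟩, ⟨i', j', k'⟩⟩
  simp only [TT, Pi.single_apply, Prod.mk.injEq]
  split_ifs <;> simp_all

lemma TT_single' {n : ℕ} (a b c : Fin 2) (i j k : Fin n) :
    TT (Pi.single a 1) (Pi.single b 1) (Pi.single c 1)
      (Pi.single i 1) (Pi.single j 1) (Pi.single k 1) = Pi.single ((a, b, c), (i, j, k)) 1 :=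
  TT_single ((a, b, c), (i, j, k))

def AA (n : ℕ) : Submodule ℂ (Idx n → ℂ) where
  carrier := {f | (∀ a b c i j k, f ((a, b, c), (i, j, k)) = f ((a, c, b), (i, j, k))) ∧
    (∀ a b c i j k, f ((a, b, c), (i, j, k)) = f ((a, b, c), (i, k, j)))}
  add_mem' := by
    rintro f g ⟨h1, h2⟩ ⟨h3, h4⟩
    exact ⟨fun a b c i j k => by simp only [Pi.add_apply]; rw [h1, h3],
      fun a b c i j k => by simp only [Pi.add_apply]; rw [h2, h4]⟩
  zero_mem' := by simp
  smul_mem' := by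
    rintro t f ⟨h1, h2⟩
    exact ⟨fun a b c i j k => by simp only [Pi.smul_apply]; rw [h1],
      fun a b c i j k => by simp only [Pi.smul_apply]; rw [h2]⟩

def BB (n : ℕ) : Submodule ℂ (Idx n → ℂ) where
  carrier := {f | (∀ a b c i j k, f ((a, b, c), (i, j, k)) = f ((c, b, a), (i, j, k))) ∧
    (∀ a b c j, ∑ i, f ((a, b, c), (i, j, i)) = 0)}
  add_mem' := by
    rintro f g ⟨h1, h2⟩ ⟨h3, h4⟩
    exact ⟨fun a b c i j k => by simp only [Pi.add_apply]; rw [h1, h3],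
      fun a b c j => by simp only [Pi.add_apply, Finset.sum_add_distrib]; rw [h2, h4, add_zero]⟩
  zero_mem' := by simp
  smul_mem' := by
    rintro t f ⟨h1, h2⟩
    exact ⟨fun a b c i j k => by simp only [Pi.smul_apply]; rw [h1],
      fun a b c j => by simp only [Pi.smul_apply, ← Finset.smul_sum]; rw [h2, smul_zero]⟩

lemma sum_single_invol {I : Type*} [Fintype I] [DecidableEq I] (f : I → ℂ) (t : I → I)
    (ht : Function.Involutive t) (hf : ∀ p, f (t p) = f p) :
    ∑ p, f p • (Pi.single (t p) 1 : I → ℂ) = f := by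
  funext x
  simp only [Finset.sum_apply, Pi.smul_apply, Pi.single_apply, smul_eq_mul, mul_ite, mul_one, mul_zero]
  rw [Finset.sum_eq_single (t x)]
  · simp [ht x, hf]
  · intro b _ hb
    rw [if_neg]
    rintro rfl
    exact hb (ht b).symm
  · simp

lemma AA_le {n : ℕ} (M : Submodule ℂ (Idx n → ℂ))
    (hA : ∀ (σ : Fin 2 → ℂ) (φ : Fin n → ℂ), TT (star σ) σ σ (star φ) φ φ ∈ M) : AA n ≤ M := by
  have h1 : ∀ a b c (φ : Fin n → ℂ), TT a b c (star φ) φ φ + TT a c b (star φ) φ φ ∈ M :=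
    fun a b c φ => polar_sym _ (TT_lin_left (star φ) φ φ) M (fun σ => hA σ φ) a b c
  have h2 : ∀ a b c (x y z : Fin n → ℂ), (TT a b c x y z + TT a c b x y z)
      + (TT a b c x z y + TT a c b x z y) ∈ M := fun a b c x y z =>
    polar_sym _ ((TT_lin_right a b c).add (TT_lin_right a c b)) M (fun φ => h1 a b c φ) x y z
  rintro f ⟨f1, f2⟩
  have e0 := sum_single_invol f id (fun _ => rfl) (fun _ => rfl)
  have e1 := sum_single_invol f (fun p => ((p.1.1, p.1.2.2, p.1.2.1), p.2)) (fun _ => rfl)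
    (fun p => (f1 _ _ _ _ _ _).symm)
  have e2 := sum_single_invol f (fun p => (p.1, (p.2.1, p.2.2.2, p.2.2.1))) (fun _ => rfl)
    (fun p => (f2 _ _ _ _ _ _).symm)
  have e3 := sum_single_invol f (fun p => ((p.1.1, p.1.2.2, p.1.2.1), (p.2.1, p.2.2.2, p.2.2.1)))
    (fun _ => rfl) (fun p => ((f1 _ _ _ _ _ _).trans (f2 _ _ _ _ _ _)).symm)
  have e : f = (1 / 4 : ℂ) • ∑ p, f p • ((Pi.single (id p) 1
      + Pi.single ((p.1.1, p.1.2.2, p.1.2.1), p.2) 1)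
      + (Pi.single (p.1, (p.2.1, p.2.2.2, p.2.2.1)) 1
      + Pi.single ((p.1.1, p.1.2.2, p.1.2.1), (p.2.1, p.2.2.2, p.2.2.1)) 1) : Idx n → ℂ) := by
    simp only [smul_add, Finset.sum_add_distrib]
    rw [e0, e1, e2, e3]
    module
  rw [e]
  refine M.smul_mem _ (M.sum_mem fun p _ => M.smul_mem _ ?_)
  have := h2 (Pi.single p.1.1 1) (Pi.single p.1.2.1 1) (Pi.single p.1.2.2 1)
      (Pi.single p.2.1 1) (Pi.single p.2.2.1 1) (Pi.single p.2.2.2 1)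
  simp only [TT_single'] at this
  exact this

lemma BB_le {n : ℕ} (hn : 0 < n) (M : Submodule ℂ (Idx n → ℂ))
    (hB : ∀ (σ : Fin 2 → ℂ) (φ w : Fin n → ℂ), star φ ⬝ᵥ w = 0 →
      TT (star σ) σ (star σ) (star φ) φ w ∈ M) : BB n ≤ M := by
  have h1 : ∀ a b c (φ w : Fin n → ℂ), star φ ⬝ᵥ w = 0 →
      TT a b c (star φ) φ w + TT c b a (star φ) φ w ∈ M :=
    fun a b c φ w hw => polar_sym _ (TT_lin_left (star φ) φ w).swap M (fun σ => by
      simpa using hB (star σ) φ w hw) b a c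
  rintro f ⟨f1, f2⟩
  have e0 := sum_single_invol f id (fun _ => rfl) (fun _ => rfl)
  have e1 := sum_single_invol f (fun p => ((p.1.2.2, p.1.2.1, p.1.1), p.2)) (fun _ => rfl)
    (fun p => (f1 _ _ _ _ _ _).symm)
  have e : f = (1 / 2 : ℂ) • ∑ p, f p • (Pi.single (id p) 1
      + Pi.single ((p.1.2.2, p.1.2.1, p.1.1), p.2) 1 : Idx n → ℂ) := by
    simp only [smul_add, Finset.sum_add_distrib]
    rw [e0, e1]
    module
  rw [e, Fintype.sum_prod_type]
  refine M.smul_mem _ (M.sum_mem fun s _ => ?_)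
  obtain ⟨a, b, c⟩ := s
  simp only [Fintype.sum_prod_type, id]
  have hG := (TT_lin_right (n := n) (Pi.single a 1) (Pi.single b 1) (Pi.single c 1)).add
    (TT_lin_right (Pi.single c 1) (Pi.single b 1) (Pi.single a 1))
  have h3 := off_mem_s17 _ hG M (fun x w => h1 _ _ _ x w)
  have h4 := diag_mem_s17 _ hG M (fun x w => h1 _ _ _ x w) ⟨0, hn⟩
  simp only [TT_single'] at h3 h4
  exact traceless_sum M (fun i j k => (Pi.single ((a, b, c), (i, j, k)) 1
      + Pi.single ((c, b, a), (i, j, k)) 1 : Idx n → ℂ)) ⟨0, hn⟩ h3 h4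
    (fun i j k => f ((a, b, c), (i, j, k))) (fun j => f2 a b c j)

lemma TT_mem_AA {n : ℕ} (σ : Fin 2 → ℂ) (φ : Fin n → ℂ) : TT (star σ) σ σ (star φ) φ φ ∈ AA n :=
  ⟨fun a b c i j k => by simp only [TT]; ring, fun a b c i j k => by simp only [TT]; ring⟩

lemma TT_mem_BB {n : ℕ} (σ : Fin 2 → ℂ) (φ w : Fin n → ℂ) (h : star φ ⬝ᵥ w = 0) :
    TT (star σ) σ (star σ) (star φ) φ w ∈ BB n :=
  ⟨fun a b c i j k => by simp only [TT]; ring, fun a b c j => by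
    have : ∀ i, TT (star σ) σ (star σ) (star φ) φ w ((a, b, c), (i, j, i))
      = (star σ a * σ b * star σ c * φ j) * (star φ i * w i) := fun i => by simp [TT]; ring
    simp only [this, ← Finset.mul_sum]
    simp only [dotProduct] at h
    rw [h, mul_zero]⟩

lemma finrank_AA (n : ℕ) : Module.finrank ℂ (AA n) = 6 * n * Fintype.card (Sym2 (Fin n)) := by
  have := finrank_aux (I := Idx n) (Q := (Fin 2 × Sym2 (Fin 2)) × (Fin n × Sym2 (Fin n))) (R := Empty)
    (fun p => ((p.1.1, s(p.1.2.1, p.1.2.2)), (p.2.1, s(p.2.2.1, p.2.2.2))))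
    (by
      rintro ⟨⟨a, S⟩, ⟨i, U⟩⟩
      induction S with | _ b c
      induction U with | _ j k
      exact ⟨((a, b, c), (i, j, k)), rfl⟩)
    0 (fun g => ⟨0, Subsingleton.elim _ _⟩) (AA n)
    (fun g _ => ⟨fun a b c i j k => by simp [Sym2.eq_swap (a := b)], fun a b c i j k => by
      simp [Sym2.eq_swap (a := j)]⟩)
    (by
      rintro f ⟨f1, f2⟩ ⟨⟨a, b, c⟩, ⟨i, j, k⟩⟩ ⟨⟨a', b', c'⟩, ⟨i', j', k'⟩⟩ h
      simp only [Prod.mk.injEq, Sym2.eq_iff] at h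
      obtain ⟨⟨rfl, h1⟩, rfl, h2⟩ := h
      rcases h1 with ⟨rfl, rfl⟩ | ⟨rfl, rfl⟩ <;> rcases h2 with ⟨rfl, rfl⟩ | ⟨rfl, rfl⟩
      · rfl
      · exact f2 _ _ _ _ _ _
      · exact f1 _ _ _ _ _ _
      · exact (f1 _ _ _ _ _ _).trans (f2 _ _ _ _ _ _))
    (fun g _ => rfl)
  simp only [Fintype.card_empty, add_zero, Fintype.card_prod, Fintype.card_fin] at this
  rw [this, Sym2.card]
  simp [Nat.choose]
  ring

lemma finrank_BB (n : ℕ) (hn : 0 < n) : Module.finrank ℂ (BB n) + 6 * n = 6 * n ^ 3 := by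
  have := finrank_aux (I := Idx n) (Q := (Fin 2 × Sym2 (Fin 2)) × (Fin n × Fin n × Fin n))
    (R := (Fin 2 × Sym2 (Fin 2)) × Fin n)
    (fun p => ((p.1.2.1, s(p.1.1, p.1.2.2)), p.2))
    (by
      rintro ⟨⟨a, S⟩, ⟨i, U⟩⟩
      induction S with | _ b c
      exact ⟨((b, a, c), (i, U)), rfl⟩)
    (LinearMap.pi fun r => ∑ i, LinearMap.proj (r.1, (i, r.2, i)))
    (fun g => ⟨fun p => if p.2.1 = ⟨0, hn⟩ then g (p.1, p.2.2.1) else 0, by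
      funext r; simp⟩) (BB n)
    (fun g hg => ⟨fun a b c i j k => by simp [Sym2.eq_swap (a := a)], fun a b c j => by
      simpa using congrFun hg ((b, s(a, c)), j)⟩)
    (by
      rintro f ⟨f1, f2⟩ ⟨⟨a, b, c⟩, U⟩ ⟨⟨a', b', c'⟩, U'⟩ h
      simp only [Prod.mk.injEq, Sym2.eq_iff] at h
      obtain ⟨⟨rfl, h1⟩, rfl⟩ := h
      rcases h1 with ⟨rfl, rfl⟩ | ⟨rfl, rfl⟩
      · rfl
      · exact f1 _ _ _ _ _ _)
    (by
      rintro g ⟨_, g2⟩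
      funext ⟨⟨b, S⟩, j⟩
      induction S with | _ a c
      simpa using g2 a b c j)
  simp only [Fintype.card_prod, Fintype.card_fin] at this
  rw [Sym2.card] at this
  simp [Nat.choose] at this
  linarith [this, (by ring : 2 * 3 * (n * (n * n)) = 6 * n ^ 3)]

def qsum (a b c : Fin 2) : Fin 4 := ⟨a.1 + b.1 + c.1, by omega⟩

lemma qsum_swap1 (a b c : Fin 2) : qsum a b c = qsum a c b := by
  simp only [qsum, Fin.mk.injEq]; omega

lemma qsum_swap2 (a b c : Fin 2) : qsum a b c = qsum c b a := by
  simp only [qsum, Fin.mk.injEq]; omega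

lemma qsum_factor {X : Type*} (f : Fin 2 → Fin 2 → Fin 2 → X)
    (h1 : ∀ a b c, f a b c = f a c b) (h2 : ∀ a b c, f a b c = f c b a) (a b c a' b' c' : Fin 2)
    (h : qsum a b c = qsum a' b' c') : f a b c = f a' b' c' := by
  have e1 : f 0 0 1 = f 0 1 0 := h1 _ _ _
  have e2 : f 0 0 1 = f 1 0 0 := h2 _ _ _
  have e3 : f 1 0 1 = f 1 1 0 := h1 _ _ _
  have e4 : f 0 1 1 = f 1 1 0 := h2 _ _ _
  have key : ∀ a b c, f a b c = ![f 0 0 0, f 0 0 1, f 1 1 0, f 1 1 1] (qsum a b c) := by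
    intro a b c
    match a, b, c with
    | 0, 0, 0 => rfl
    | 0, 0, 1 => rfl
    | 0, 1, 0 => exact e1.symm
    | 1, 0, 0 => exact e2.symm
    | 1, 1, 0 => rfl
    | 1, 0, 1 => exact e3
    | 0, 1, 1 => exact e4
    | 1, 1, 1 => rfl
  rw [key, key a', h]

lemma finrank_AB (n : ℕ) :
    Module.finrank ℂ (AA n ⊓ BB n : Submodule ℂ (Idx n → ℂ)) + 4 * n
      = 4 * n * Fintype.card (Sym2 (Fin n)) := by
  have := finrank_aux (I := Idx n) (Q := Fin 4 × (Fin n × Sym2 (Fin n)))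
    (R := Fin 4 × Fin n)
    (fun p => (qsum p.1.1 p.1.2.1 p.1.2.2, (p.2.1, s(p.2.2.1, p.2.2.2))))
    (by
      rintro ⟨a, ⟨i, U⟩⟩
      induction U with | _ j k
      have : ∃ x y z, qsum x y z = a := by revert a; decide
      obtain ⟨x, y, z, rfl⟩ := this
      exact ⟨((x, y, z), (i, j, k)), rfl⟩)
    (LinearMap.pi fun r => ∑ i, LinearMap.proj (r.1, (i, s(r.2, i))))
    (fun g => ⟨fun p => if p.2.2 = s(p.2.1, p.2.1) then g (p.1, p.2.1) else 0, by
      funext r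
      have hr : ∀ i, s(r.2, i) = s(i, i) ↔ r.2 = i := fun i => by simp only [Sym2.eq_iff]; tauto
      simp [LinearMap.sum_apply, hr]⟩) (AA n ⊓ BB n)
    (fun g hg => ⟨⟨fun a b c i j k => congrArg (fun t => g (t, (i, s(j, k)))) (qsum_swap1 a b c), fun a b c i j k => by
      simp [Sym2.eq_swap (a := j)]⟩, ⟨fun a b c i j k => congrArg (fun t => g (t, (i, s(j, k)))) (qsum_swap2 a b c), fun a b c j => by
      simpa using congrFun hg (qsum a b c, j)⟩⟩)
    (by
      rintro f ⟨⟨f1, f2⟩, ⟨f3, f4⟩⟩ ⟨⟨a, b, c⟩, ⟨i, j, k⟩⟩ ⟨⟨a', b', c'⟩, ⟨i', j', k'⟩⟩ h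
      simp only [Prod.mk.injEq, Sym2.eq_iff] at h
      obtain ⟨h1, rfl, h2⟩ := h
      have : f ((a, b, c), (i, j, k)) = f ((a', b', c'), (i, j, k)) :=
        qsum_factor (fun a b c => f ((a, b, c), (i, j, k))) (fun a b c => f1 _ _ _ _ _ _)
          (fun a b c => f3 _ _ _ _ _ _) a b c a' b' c' h1
      rw [this]
      rcases h2 with ⟨rfl, rfl⟩ | ⟨rfl, rfl⟩
      · rfl
      · exact f2 _ _ _ _ _ _)
    (by
      rintro g ⟨_, ⟨_, g2⟩⟩
      funext ⟨a, j⟩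
      have : ∃ x y z, qsum x y z = a := by revert a; decide
      obtain ⟨x, y, z, rfl⟩ := this
      simpa using g2 x y z j)
  simp only [Fintype.card_prod, Fintype.card_fin] at this
  linarith

lemma finrank_sup (n : ℕ) (hn : 2 ≤ n) :
    Module.finrank ℂ (AA n ⊔ BB n : Submodule ℂ (Idx n → ℂ)) = 7 * n ^ 3 + n ^ 2 - 2 * n := by
  have h0 := Submodule.finrank_sup_add_finrank_inf_eq (AA n) (BB n)
  have h1 := finrank_AA n
  have h2 := finrank_BB n (by omega)
  have h3 := finrank_AB n
  have hc : 2 * Fintype.card (Sym2 (Fin n)) = n * (n + 1) := by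
    rw [Sym2.card, Fintype.card_fin, Nat.choose_two_right, Nat.mul_div_cancel' (Nat.even_mul_pred_self _).two_dvd]
    simp; ring
  have hc' : 2 * n * Fintype.card (Sym2 (Fin n)) = n ^ 3 + n ^ 2 := by
    rw [mul_comm 2 n, mul_assoc, hc]; ring
  have h4 : 6 * n * Fintype.card (Sym2 (Fin n)) = 3 * (n ^ 3 + n ^ 2) := by rw [← hc']; ring
  have h5 : 4 * n * Fintype.card (Sym2 (Fin n)) = 2 * (n ^ 3 + n ^ 2) := by rw [← hc']; ring
  omega

def sumE (n : ℕ) : Fin 2 × Fin n ≃ Fin n ⊕ Fin n where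
  toFun p := if p.1 = 0 then Sum.inl p.2 else Sum.inr p.2
  invFun := Sum.elim (fun i => (0, i)) (fun i => (1, i))
  left_inv := by
    rintro ⟨s, i⟩
    fin_cases s <;> simp
  right_inv := by rintro (i | i) <;> simp

def idxE (n : ℕ) : Idx n ≃ (Fin n ⊕ Fin n) × (Fin n ⊕ Fin n) × (Fin n ⊕ Fin n) where
  toFun p := (sumE n (p.1.1, p.2.1), sumE n (p.1.2.1, p.2.2.1), sumE n (p.1.2.2, p.2.2.2))
  invFun r := ((((sumE n).symm r.1).1, ((sumE n).symm r.2.1).1, ((sumE n).symm r.2.2).1),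
    (((sumE n).symm r.1).2, ((sumE n).symm r.2.1).2, ((sumE n).symm r.2.2).2))
  left_inv := by rintro ⟨⟨a, b, c⟩, ⟨i, j, k⟩⟩; simp
  right_inv := by rintro ⟨a, b, c⟩; simp

lemma elim_sumE {n : ℕ} (σ : Fin 2 → ℂ) (φ : Fin n → ℂ) (s : Fin 2) (i : Fin n) :
    Sum.elim (fun i => σ 0 * φ i) (fun i => σ 1 * φ i) (sumE n (s, i)) = σ s * φ i := by
  fin_cases s <;> simp [sumE]

lemma vmv_blocks {n : ℕ} (a b : ℂ) (φ : Fin n → ℂ) :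
    Matrix.vecMulVec (Sum.elim (fun i => a * φ i) (fun i => b * φ i))
      (star (Sum.elim (fun i => a * φ i) (fun i => b * φ i)))
    = Matrix.fromBlocks ((a * star a) • Matrix.vecMulVec φ (star φ))
      ((a * star b) • Matrix.vecMulVec φ (star φ)) ((b * star a) • Matrix.vecMulVec φ (star φ))
      ((b * star b) • Matrix.vecMulVec φ (star φ)) := by
  ext (i | i) (j | j) <;> simp [Matrix.vecMulVec_apply] <;> ring

lemma phi_eq {n : ℕ} (a b : ℂ) (φ u v : Fin n → ℂ) :
    (Phi n (Matrix.vecMulVec (Sum.elim (fun i => a * φ i) (fun i => b * φ i))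
      (star (Sum.elim (fun i => a * φ i) (fun i => b * φ i))))).mulVec (Sum.elim u v)
    = (n : ℂ)⁻¹ • Sum.elim
      (fun i => b * star b * (star φ ⬝ᵥ φ) * u i - a * star b * (star φ ⬝ᵥ v) * φ i
        - b * star a * ((star φ ⬝ᵥ φ) * v i - (star φ ⬝ᵥ v) * φ i))
      (fun i => a * star a * (star φ ⬝ᵥ φ) * v i - b * star a * (star φ ⬝ᵥ u) * φ i
        - a * star b * ((star φ ⬝ᵥ φ) * u i - (star φ ⬝ᵥ u) * φ i)) := by
  rw [vmv_blocks, Phi, Matrix.smul_mulVec]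
  congr 1
  rw [Matrix.fromBlocks_mulVec]
  simp only [Matrix.toBlocks_fromBlocks₁₁, Matrix.toBlocks_fromBlocks₁₂,
    Matrix.toBlocks_fromBlocks₂₁, Matrix.toBlocks_fromBlocks₂₂, Rmap, Matrix.trace_smul,
    Matrix.trace_vecMulVec, Matrix.sub_mulVec, Matrix.neg_mulVec, Matrix.smul_mulVec,
    Matrix.one_mulVec, Matrix.vecMulVec_mulVec, dotProduct_comm φ (star φ)]
  funext x
  rcases x with i | i <;> simp <;> ring

lemma phi_zero_iff {n : ℕ} (hn : 2 ≤ n) (a b : ℂ) (φ u v : Fin n → ℂ) :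
    (Phi n (Matrix.vecMulVec (Sum.elim (fun i => a * φ i) (fun i => b * φ i))
      (star (Sum.elim (fun i => a * φ i) (fun i => b * φ i))))).mulVec (Sum.elim u v) = 0 ↔
    (∀ i, b * star b * (star φ ⬝ᵥ φ) * u i - a * star b * (star φ ⬝ᵥ v) * φ i
        - b * star a * ((star φ ⬝ᵥ φ) * v i - (star φ ⬝ᵥ v) * φ i) = 0) ∧
    (∀ i, a * star a * (star φ ⬝ᵥ φ) * v i - b * star a * (star φ ⬝ᵥ u) * φ i
        - a * star b * ((star φ ⬝ᵥ φ) * u i - (star φ ⬝ᵥ u) * φ i) = 0) := by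
  have h0 : (n : ℂ)⁻¹ ≠ 0 := by simp; omega
  rw [phi_eq, smul_eq_zero_iff_right h0]
  constructor
  · intro h
    exact ⟨fun i => congrFun h (Sum.inl i), fun i => congrFun h (Sum.inr i)⟩
  · rintro ⟨h1, h2⟩
    funext x
    rcases x with i | i
    · exact h1 i
    · exact h2 i

lemma gen_eq {n : ℕ} (σ : Fin 2 → ℂ) (φ : Fin n → ℂ) (τ : Fin 2 → ℂ) (w : Fin n → ℂ) :
    LinearEquiv.funCongrLeft ℂ ℂ (idxE n) (fun p : (Fin n ⊕ Fin n) × (Fin n ⊕ Fin n) × (Fin n ⊕ Fin n) =>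
              conj (Sum.elim (fun i => σ 0 * φ i) (fun i => σ 1 * φ i) p.1) *
                Sum.elim (fun i => σ 0 * φ i) (fun i => σ 1 * φ i) p.2.1 *
                Sum.elim (fun i => τ 0 * w i) (fun i => τ 1 * w i) p.2.2)
      = TT (star σ) σ τ (star φ) φ w := by
  funext p
  simp only [LinearEquiv.funCongrLeft_apply, LinearMap.funLeft_apply, idxE, Equiv.coe_fn_mk,
    elim_sumE, TT, map_mul, Pi.star_apply, Complex.star_def]
  ring

/-- kernel vectors decompose -/
lemma ker_decomp {n : ℕ} (σ : Fin 2 → ℂ) (φ u v : Fin n → ℂ) (hφ : φ ≠ 0) (hσ : σ ≠ 0)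
    (h : (∀ i, σ 1 * star (σ 1) * (star φ ⬝ᵥ φ) * u i - σ 0 * star (σ 1) * (star φ ⬝ᵥ v) * φ i
        - σ 1 * star (σ 0) * ((star φ ⬝ᵥ φ) * v i - (star φ ⬝ᵥ v) * φ i) = 0) ∧
    (∀ i, σ 0 * star (σ 0) * (star φ ⬝ᵥ φ) * v i - σ 1 * star (σ 0) * (star φ ⬝ᵥ u) * φ i
        - σ 0 * star (σ 1) * ((star φ ⬝ᵥ φ) * u i - (star φ ⬝ᵥ u) * φ i) = 0)) :
    ∃ (c : ℂ) (w : Fin n → ℂ), star φ ⬝ᵥ w = 0 ∧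
      Sum.elim u v = c • Sum.elim (fun i => σ 0 * φ i) (fun i => σ 1 * φ i)
        + Sum.elim (fun i => star σ 0 * w i) (fun i => star σ 1 * w i) := by
  have ht : star φ ⬝ᵥ φ ≠ 0 := by
    rw [Ne, dotProduct_star_self_eq_zero]; exact hφ
  have hs : σ 0 * star (σ 0) + σ 1 * star (σ 1) ≠ 0 := by
    have : star σ ⬝ᵥ σ ≠ 0 := by rw [Ne, dotProduct_star_self_eq_zero]; exact hσ
    simp only [dotProduct, Fin.sum_univ_two, Pi.star_apply] at this
    rwa [mul_comm (σ 0), mul_comm (σ 1)]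
  obtain ⟨h1, h2⟩ := h
  set t := star φ ⬝ᵥ φ with htd
  set pu := star φ ⬝ᵥ u
  set pv := star φ ⬝ᵥ v
  set s := σ 0 * star (σ 0) + σ 1 * star (σ 1) with hsd
  refine ⟨(star (σ 0) * pu + star (σ 1) * pv) / (t * s),
    (1 / s) • (σ 0 • u + σ 1 • v) - ((σ 0 * pu + σ 1 * pv) / (s * t)) • φ, ?_, ?_⟩
  · simp only [dotProduct_sub, dotProduct_smul, dotProduct_add, smul_eq_mul]
    change 1 / s * (σ 0 * pu + σ 1 * pv) - (σ 0 * pu + σ 1 * pv) / (s * t) * t = 0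
    field_simp
    ring
  · funext x
    rcases x with i | i
    · have := h1 i
      simp only [Pi.add_apply, Pi.smul_apply, Sum.elim_inl, Pi.sub_apply, smul_eq_mul, Pi.star_apply]
      field_simp
      rw [hsd]
      linear_combination this
    · have := h2 i
      simp only [Pi.add_apply, Pi.smul_apply, Sum.elim_inr, Pi.sub_apply, smul_eq_mul, Pi.star_apply]
      field_simp
      rw [hsd]
      linear_combination this

/-- The subspace `W ⊂ (ℂ^{2n})^{⊗3}` spanned by the tensors `x̄ ⊗ x ⊗ y` where
`x = σ ⊗ φ` is a product vector (its two `ℂ^n` components are parallel) and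
`Φ_n(|x⟩⟨x|) y = 0`, has dimension `7n³ + n² − 2n`. -/
theorem dim_W (n : ℕ) (hn : 2 ≤ n) :
    Module.finrank ℂ
      ↥(Submodule.span ℂ
        {Ψ : (Fin n ⊕ Fin n) × (Fin n ⊕ Fin n) × (Fin n ⊕ Fin n) → ℂ |
          ∃ (σ : Fin 2 → ℂ) (φ : Fin n → ℂ) (y : Fin n ⊕ Fin n → ℂ),
            (Phi n (Matrix.vecMulVec
                (Sum.elim (fun i => σ 0 * φ i) (fun i => σ 1 * φ i))
                (star (Sum.elim (fun i => σ 0 * φ i)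
                  (fun i => σ 1 * φ i))))).mulVec y = 0 ∧
            Ψ = fun p =>
              conj (Sum.elim (fun i => σ 0 * φ i) (fun i => σ 1 * φ i) p.1) *
                Sum.elim (fun i => σ 0 * φ i) (fun i => σ 1 * φ i) p.2.1 *
                y p.2.2}) = 7 * n ^ 3 + n ^ 2 - 2 * n := by
  rw [← finrank_sup n hn, ← LinearEquiv.finrank_map_eq (LinearEquiv.funCongrLeft ℂ ℂ (idxE n)),
    Submodule.map_span]
  refine congrArg (fun U : Submodule ℂ (Idx n → ℂ) => Module.finrank ℂ U) ?_
  apply le_antisymm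
  · rw [Submodule.span_le]
    rintro _ ⟨Ψ, ⟨σ, φ, y, hy, rfl⟩, rfl⟩
    rw [SetLike.mem_coe, LinearEquiv.coe_coe]
    obtain ⟨u, v, rfl⟩ : ∃ u v, y = Sum.elim u v := ⟨y ∘ Sum.inl, y ∘ Sum.inr, by simp⟩
    by_cases hφ : φ = 0
    · subst hφ
      convert Submodule.zero_mem (AA n ⊔ BB n) using 1
      funext p
      simp only [LinearEquiv.coe_coe, LinearEquiv.funCongrLeft_apply, LinearMap.funLeft_apply, idxE, Equiv.coe_fn_mk, elim_sumE]
      simp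
    by_cases hσ : σ = 0
    · subst hσ
      convert Submodule.zero_mem (AA n ⊔ BB n) using 1
      funext p
      simp only [LinearEquiv.coe_coe, LinearEquiv.funCongrLeft_apply, LinearMap.funLeft_apply, idxE, Equiv.coe_fn_mk, elim_sumE]
      simp
    obtain ⟨c, w, hw, e⟩ := ker_decomp σ φ u v hφ hσ ((phi_zero_iff hn _ _ _ _ _).1 hy)
    have h1 := (AA n).smul_mem c (TT_mem_AA σ φ)
    have h2 := TT_mem_BB σ φ w hw
    convert Submodule.add_mem_sup h1 h2 using 1
    rw [← gen_eq, ← gen_eq, ← map_smul, ← map_add, e]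
    refine congrArg (LinearEquiv.funCongrLeft ℂ ℂ (idxE n)) ?_
    funext p
    simp only [Pi.add_apply, Pi.smul_apply, smul_eq_mul]
    ring
  · apply sup_le
    · apply AA_le
      intro σ φ
      rw [← gen_eq]
      refine Submodule.subset_span ⟨_, ⟨σ, φ, _, ?_, rfl⟩, rfl⟩
      rw [phi_zero_iff hn]
      have e : ∀ s : ℂ, star φ ⬝ᵥ (fun i => s * φ i) = s * (star φ ⬝ᵥ φ) := fun s =>
        dotProduct_smul s (star φ) φ
      simp only [e]
      exact ⟨fun i => by ring, fun i => by ring⟩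
    · apply BB_le (by omega)
      intro σ φ w hw
      rw [← gen_eq]
      refine Submodule.subset_span ⟨_, ⟨σ, φ, _, ?_, rfl⟩, rfl⟩
      rw [phi_zero_iff hn]
      have e : ∀ s : ℂ, star φ ⬝ᵥ (fun i => s * w i) = 0 := fun s =>
        (dotProduct_smul s (star φ) w).trans (by rw [hw, smul_zero])
      simp only [e, Pi.star_apply]
      exact ⟨fun i => by ring, fun i => by ring⟩
end

section
/- For n = 2, the map Φ₂ on M₄(ℂ) (the Robertson map) given blockwise by Φ₂([[X11,X12],[X21,X22]]) = (1/2)[[I₂ Tr X22, −X12 − R₂(X21)],[−X21 − R₂(X12), I₂ Tr X11]] is an extremal positive map: if Λ is a positive map such that Φ₂ − Λ is positive, then Λ = λΦ₂ for some λ ∈ [0,1]. -/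
open scoped ComplexOrder

/-- The conjugate of the antiunitary `x ↦ U x̄`; it is linear. -/
noncomputable def vmap (a : Fin 2 ⊕ Fin 2 → ℂ) : Fin 2 ⊕ Fin 2 → ℂ :=
  Sum.elim ![-a (Sum.inl 1), a (Sum.inl 0)] ![-a (Sum.inr 1), a (Sum.inr 0)]

lemma vmap_add (a b : Fin 2 ⊕ Fin 2 → ℂ) : vmap (a + b) = vmap a + vmap b := by
  ext i
  rcases i with i | i <;> fin_cases i <;> simp [vmap] <;> ring

lemma vmap_smul (t : ℂ) (a : Fin 2 ⊕ Fin 2 → ℂ) : vmap (t • a) = t • vmap a := by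
  ext i
  rcases i with i | i <;> fin_cases i <;> simp [vmap]

lemma polar {V : Type*} [AddCommGroup V] [Module ℂ V] [StarAddMonoid V] [StarModule ℂ V]
    (f : V → V → V → ℂ)
    (a1 : ∀ x x' y z, f (x + x') y z = f x y z + f x' y z)
    (a2 : ∀ x y y' z, f x (y + y') z = f x y z + f x y' z)
    (a3 : ∀ x y z z', f x y (z + z') = f x y z + f x y z')
    (s1 : ∀ (t : ℂ) x y z, f (t • x) y z = t * f x y z)
    (s2 : ∀ (t : ℂ) x y z, f x (t • y) z = t * f x y z)
    (s3 : ∀ (t : ℂ) x y z, f x y (t • z) = t * f x y z)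
    (h : ∀ x, f x x (star x) = 0) (x y z : V) : f x y z = - f y x z := by
  have key : ∀ x z, f x x z = 0 := by
    intro x z
    have e : ∀ t : ℂ, f (x + t • star z) (x + t • star z) (star x + star t • z) = 0 := by
      intro t
      have := h (x + t • star z)
      simpa [star_add, star_smul] using this
    simp only [a1, a2, a3, s1, s2, s3] at e
    have e1 := e 1
    have e2 := e (-1)
    have e3 := e Complex.I
    have e4 := e (-Complex.I)
    simp only [star_one, star_neg, Complex.star_def, Complex.conj_I] at e1 e2 e3 e4
    have hI : Complex.I * Complex.I = -1 := Complex.I_mul_I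
    grind
  have := key (x + y) z
  rw [a1, a2, a2, key, key] at this
  linear_combination this

lemma Phi_ker (x : Fin 2 ⊕ Fin 2 → ℂ) :
    (Phi 2 (Matrix.vecMulVec x (star x))).mulVec x = 0 := by
  ext i
  rcases i with i | i <;> fin_cases i <;>
    simp [Phi, Rmap, Matrix.mulVec, dotProduct, Matrix.trace, Matrix.vecMulVec_apply,
      Matrix.toBlocks₁₁, Matrix.toBlocks₁₂, Matrix.toBlocks₂₁, Matrix.toBlocks₂₂] <;> ring

lemma Phi_ker' (x : Fin 2 ⊕ Fin 2 → ℂ) :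
    (Phi 2 (Matrix.vecMulVec x (star x))).mulVec (star (vmap x)) = 0 := by
  ext i
  rcases i with i | i <;> fin_cases i <;>
    simp [Phi, Rmap, vmap, Matrix.mulVec, dotProduct, Matrix.trace, Matrix.vecMulVec_apply,
      Matrix.toBlocks₁₁, Matrix.toBlocks₁₂, Matrix.toBlocks₂₁, Matrix.toBlocks₂₂] <;> ring

lemma Phi_herm (x : Fin 2 ⊕ Fin 2 → ℂ) :
    (Phi 2 (Matrix.vecMulVec x (star x))).IsHermitian := by
  ext i j
  rcases i with i | i <;> fin_cases i <;> rcases j with j | j <;> fin_cases j <;>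
    simp [Phi, Rmap, Matrix.trace, Matrix.vecMulVec_apply,
      Matrix.toBlocks₁₁, Matrix.toBlocks₁₂, Matrix.toBlocks₂₁, Matrix.toBlocks₂₂] <;> ring

noncomputable def PhiL : Matrix (Fin 2 ⊕ Fin 2) (Fin 2 ⊕ Fin 2) ℂ →ₗ[ℂ]
      Matrix (Fin 2 ⊕ Fin 2) (Fin 2 ⊕ Fin 2) ℂ where
  toFun := Phi 2
  map_add' X Y := by
    ext i j
    rcases i with i | i <;> fin_cases i <;> rcases j with j | j <;> fin_cases j <;>
      simp [Phi, Rmap, Matrix.trace, 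
        Matrix.toBlocks₁₁, Matrix.toBlocks₁₂, Matrix.toBlocks₂₁, Matrix.toBlocks₂₂] <;> ring
  map_smul' t X := by
    ext i j
    rcases i with i | i <;> fin_cases i <;> rcases j with j | j <;> fin_cases j <;>
      simp [Phi, Rmap, Matrix.trace, 
        Matrix.toBlocks₁₁, Matrix.toBlocks₁₂, Matrix.toBlocks₂₁, Matrix.toBlocks₂₂] <;> ring

lemma psd_ker {n : Type*} [Fintype n] {A B : Matrix n n ℂ} (hA : A.PosSemidef)
    (hB : (B - A).PosSemidef) (y : n → ℂ) (hy : B.mulVec y = 0) : A.mulVec y = 0 := by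
  classical
  rw [← hA.dotProduct_mulVec_zero_iff]
  have h1 := hA.dotProduct_mulVec_nonneg y
  have h2 := hB.dotProduct_mulVec_nonneg y
  rw [Matrix.sub_mulVec, hy, zero_sub, dotProduct_neg] at h2
  exact le_antisymm (neg_nonneg.mp h2) h1

/-- An alternating four-tensor on a four-element set vanishes if one component does. -/
lemma alt_zero (S : Fin 4 → Fin 4 → Fin 4 → Fin 4 → ℂ)
    (hbc : ∀ a b c d, S a b c d = - S a c b d)
    (hac : ∀ a b c d, S a b c d = - S c b a d)
    (had : ∀ a b c d, S a b c d = - S d b c a)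
    (h0 : S 3 2 0 1 = 0) (a b c d : Fin 4) : S a b c d = 0 := by
  have hab : ∀ a b c d, S a b c d = - S b a c d := by
    intro a b c d
    rw [hbc, hac, hbc]; simp
  have hbd : ∀ a b c d, S a b c d = - S a d c b := by
    intro a b c d
    rw [hab, had, hab]; simp
  have hcd : ∀ a b c d, S a b c d = - S a b d c := by
    intro a b c d
    rw [hac, had, hac]; simp
  have z : ∀ w : ℂ, w = -w → w = 0 := fun w hw => by linear_combination hw / 2
  by_cases e1 : a = b
  · subst e1; exact z _ (hab ..)
  by_cases e2 : a = c
  · subst e2; exact z _ (hac ..)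
  by_cases e3 : a = d
  · subst e3; exact z _ (had ..)
  by_cases e4 : b = c
  · subst e4; exact z _ (hbc ..)
  by_cases e5 : b = d
  · subst e5; exact z _ (hbd ..)
  by_cases e6 : c = d
  · subst e6; exact z _ (hcd ..)
  have pa : ∀ a b c d, S a b c d = 0 → S b a c d = 0 := fun a b c d h => by
    rw [hab, h, neg_zero]
  have pb : ∀ a b c d, S a b c d = 0 → S a c b d = 0 := fun a b c d h => by
    rw [hbc, h, neg_zero]
  have pc : ∀ a b c d, S a b c d = 0 → S a b d c = 0 := fun a b c d h => by
    rw [hcd, h, neg_zero]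
  fin_cases a <;> fin_cases b <;> first | exact absurd rfl e1 | skip
  all_goals fin_cases c <;> first | exact absurd rfl e2 | exact absurd rfl e4 | skip
  all_goals fin_cases d <;>
    first | exact absurd rfl e3 | exact absurd rfl e5 | exact absurd rfl e6 | skip
  all_goals grind

/-- The equations coming from the zeros of the map determine it. -/
lemma map_zero_of (M : Matrix (Fin 2 ⊕ Fin 2) (Fin 2 ⊕ Fin 2) ℂ →ₗ[ℂ]
      Matrix (Fin 2 ⊕ Fin 2) (Fin 2 ⊕ Fin 2) ℂ)
    (h1 : ∀ x, (M (Matrix.vecMulVec x (star x))).mulVec x = 0)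
    (h2 : ∀ x, Matrix.vecMul (star x) (M (Matrix.vecMulVec x (star x))) = 0)
    (h3 : ∀ x, Matrix.vecMul (vmap x) (M (Matrix.vecMulVec x (star x))) = 0)
    (h0 : M (Matrix.single (Sum.inl 0) (Sum.inl 0) 1) (Sum.inr 0) (Sum.inr 0) = 0) :
    M = 0 := by
  let H : (Fin 2 ⊕ Fin 2 → ℂ) → (Fin 2 ⊕ Fin 2 → ℂ) → (Fin 2 ⊕ Fin 2 → ℂ) →
    (Fin 2 ⊕ Fin 2 → ℂ) → ℂ := fun p q x k => p ⬝ᵥ (M (Matrix.vecMulVec x k)).mulVec q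
  have H1 : ∀ p q x k, H p q x k = - H p x q k := by
    intro p q x k
    refine polar (fun q x k => H p q x k) ?_ ?_ ?_ ?_ ?_ ?_ ?_ q x k <;> intros <;>
      simp [H, Matrix.vecMulVec_add, Matrix.add_vecMulVec, Matrix.vecMulVec_smul,
        Matrix.smul_vecMulVec, Matrix.mulVec_add, Matrix.add_mulVec, Matrix.mulVec_smul,
        Matrix.smul_mulVec, h1]
  have H2 : ∀ p q x k, H p q x k = - H k q x p := by
    intro p q x k
    refine polar (fun p k x => H p q x k) ?_ ?_ ?_ ?_ ?_ ?_ ?_ p k x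
    case refine_7 =>
      intro x
      have := h2 (star x)
      rw [star_star] at this
      simp [H, Matrix.dotProduct_mulVec, this]
    all_goals
      intros
      simp [H, Matrix.vecMulVec_add, Matrix.add_vecMulVec, Matrix.vecMulVec_smul,
        Matrix.smul_vecMulVec, Matrix.mulVec_add, Matrix.add_mulVec, Matrix.mulVec_smul,
        Matrix.smul_mulVec]
  have H3 : ∀ p q x k, H (vmap p) q x k = - H (vmap x) q p k := by
    intro p q x k
    refine polar (fun p x k => H (vmap p) q x k) ?_ ?_ ?_ ?_ ?_ ?_ ?_ p x k
    case refine_7 =>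
      intro x
      simp [H, Matrix.dotProduct_mulVec, h3]
    all_goals
      intros
      simp [H, Matrix.vecMulVec_add, Matrix.add_vecMulVec, Matrix.vecMulVec_smul,
        Matrix.smul_vecMulVec, Matrix.mulVec_add, Matrix.add_mulVec, Matrix.mulVec_smul,
        Matrix.smul_mulVec, vmap_add, vmap_smul]
  let e : Fin 4 → (Fin 2 ⊕ Fin 2 → ℂ) := ![Pi.single (Sum.inl 0) 1, Pi.single (Sum.inl 1) 1,
    Pi.single (Sum.inr 0) 1, Pi.single (Sum.inr 1) 1]
  have v0 : vmap (Pi.single (Sum.inl 0) 1) = Pi.single (Sum.inl 1) 1 := by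
    ext i; rcases i with i | i <;> fin_cases i <;> simp [vmap, Pi.single_apply]
  have v1 : vmap (Pi.single (Sum.inl 1) 1) = (-1 : ℂ) • Pi.single (Sum.inl 0) 1 := by
    ext i; rcases i with i | i <;> fin_cases i <;> simp [vmap, Pi.single_apply]
  have v2 : vmap (Pi.single (Sum.inr 0) 1) = Pi.single (Sum.inr 1) 1 := by
    ext i; rcases i with i | i <;> fin_cases i <;> simp [vmap, Pi.single_apply]
  have v3 : vmap (Pi.single (Sum.inr 1) 1) = (-1 : ℂ) • Pi.single (Sum.inr 0) 1 := by
    ext i; rcases i with i | i <;> fin_cases i <;> simp [vmap, Pi.single_apply]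
  have ns1 : ∀ (t : ℂ) p q x k, H (t • p) q x k = t * H p q x k := by
    intros; simp [H]
  have ns4 : ∀ (t : ℂ) p q x k, H p q x (t • k) = t * H p q x k := by
    intros; simp [H, Matrix.vecMulVec_smul, Matrix.smul_mulVec]
  have Hs : ∀ i l j k, H (Pi.single i 1) (Pi.single l 1) (Pi.single j 1) (Pi.single k 1)
      = M (Matrix.single j k 1) i l := by
    intro i l j k
    simp [H, ← Matrix.single_eq_single_vecMulVec_single]
  have key := alt_zero (fun a b c d => H (vmap (e a)) (e b) (e c) (vmap (e d)))
    (fun a b c d => H1 _ _ _ _) (fun a b c d => H3 _ _ _ _) (fun a b c d => H2 _ _ _ _)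
    (by
      change H (vmap (Pi.single (Sum.inr 1) 1)) (Pi.single (Sum.inr 0) 1)
        (Pi.single (Sum.inl 0) 1) (vmap (Pi.single (Sum.inl 1) 1)) = 0
      rw [v1, v3, ns1, ns4, Hs, h0, mul_zero, mul_zero])
  -- every basis vector is, up to sign, of both forms
  have r1 : ∀ l : Fin 2 ⊕ Fin 2, ∃ b, (Pi.single l 1 : Fin 2 ⊕ Fin 2 → ℂ) = e b := by
    intro l
    rcases l with l | l <;> fin_cases l
    exacts [⟨0, rfl⟩, ⟨1, rfl⟩, ⟨2, rfl⟩, ⟨3, rfl⟩]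
  have r2 : ∀ l : Fin 2 ⊕ Fin 2, ∃ b, ∃ t : ℂ,
      (Pi.single l 1 : Fin 2 ⊕ Fin 2 → ℂ) = t • vmap (e b) := by
    intro l
    rcases l with l | l <;> fin_cases l
    · exact ⟨1, -1, by simp [e, v1]⟩
    · exact ⟨0, 1, by simp [e, v0]⟩
    · exact ⟨3, -1, by simp [e, v3]⟩
    · exact ⟨2, 1, by simp [e, v2]⟩
  refine Matrix.ext_linearMap _ fun j k => LinearMap.ext_ring ?_
  ext i l
  obtain ⟨a, t, ha⟩ := r2 i
  obtain ⟨b, hb⟩ := r1 l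
  obtain ⟨c, hc⟩ := r1 j
  obtain ⟨d, s, hd⟩ := r2 k
  have := Hs i l j k
  rw [ha, hb, hc, hd, ns1, ns4, key a b c d] at this
  simpa using this.symm

theorem Phi2_extremal
    (Λ : Matrix (Fin 2 ⊕ Fin 2) (Fin 2 ⊕ Fin 2) ℂ →ₗ[ℂ]
      Matrix (Fin 2 ⊕ Fin 2) (Fin 2 ⊕ Fin 2) ℂ)
    (hpos : ∀ X, X.PosSemidef → (Λ X).PosSemidef)
    (hdiff : ∀ X, X.PosSemidef → (Phi 2 X - Λ X).PosSemidef) :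
    ∃ c : ℝ, 0 ≤ c ∧ c ≤ 1 ∧ ∀ X, Λ X = (c : ℂ) • Phi 2 X := by
  have hp : ∀ x : Fin 2 ⊕ Fin 2 → ℂ, (Matrix.vecMulVec x (star x)).PosSemidef :=
    fun x => Matrix.posSemidef_vecMulVec_self_star x
  have hE : (Matrix.single (Sum.inl 0) (Sum.inl 0) 1 :
      Matrix (Fin 2 ⊕ Fin 2) (Fin 2 ⊕ Fin 2) ℂ).PosSemidef := by
    have := hp (Pi.single (Sum.inl 0) 1)
    rwa [← Pi.single_star, star_one, ← Matrix.single_eq_single_vecMulVec_single] at this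
  have hP : Phi 2 (Matrix.single (Sum.inl 0) (Sum.inl 0) 1) (Sum.inr 0) (Sum.inr 0)
      = 1 / 2 := by
    simp [Phi, Matrix.trace, Matrix.toBlocks₁₁, Matrix.single_apply]
  have d1 := (hpos _ hE).diag_nonneg (i := Sum.inr 0)
  have d2 := (hdiff _ hE).diag_nonneg (i := Sum.inr 0)
  rw [Matrix.sub_apply, hP] at d2
  set w := Λ (Matrix.single (Sum.inl 0) (Sum.inl 0) 1) (Sum.inr 0) (Sum.inr 0) with hw
  rw [Complex.le_def] at d1 d2
  simp at d1 d2
  have hwr : w = (w.re : ℂ) := by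
    apply Complex.ext <;> simp [← d1.2]
  refine ⟨2 * w.re, by linarith, by linarith, ?_⟩
  have k1 : ∀ x, (Λ (Matrix.vecMulVec x (star x))).mulVec x = 0 := fun x =>
    psd_ker (hpos _ (hp x)) (hdiff _ (hp x)) x (Phi_ker x)
  have k2 : ∀ x, (Λ (Matrix.vecMulVec x (star x))).mulVec (star (vmap x)) = 0 := fun x =>
    psd_ker (hpos _ (hp x)) (hdiff _ (hp x)) _ (Phi_ker' x)
  have left : ∀ (A : Matrix (Fin 2 ⊕ Fin 2) (Fin 2 ⊕ Fin 2) ℂ) (y : Fin 2 ⊕ Fin 2 → ℂ),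
      A.IsHermitian → A.mulVec y = 0 → Matrix.vecMul (star y) A = 0 := by
    intro A y hA h
    have := Matrix.star_mulVec A y
    rw [hA.eq, h, star_zero] at this
    exact this.symm
  have hM := map_zero_of (Λ - ((2 * w.re : ℝ) : ℂ) • PhiL) ?_ ?_ ?_ ?_
  · intro X
    have := LinearMap.congr_fun hM X
    simp only [LinearMap.sub_apply, LinearMap.smul_apply, LinearMap.zero_apply] at this
    exact sub_eq_zero.mp this
  · intro x
    have := Phi_ker x
    simp only [LinearMap.sub_apply, LinearMap.smul_apply, Matrix.sub_mulVec, k1,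
      Matrix.smul_mulVec]
    change 0 - _ • (Phi 2 _).mulVec x = 0
    rw [this]; simp
  · intro x
    have a := left _ _ (hpos _ (hp x)).isHermitian (k1 x)
    have b := left _ _ (Phi_herm x) (Phi_ker x)
    simp only [LinearMap.sub_apply, LinearMap.smul_apply, Matrix.vecMul_sub, a,
      Matrix.vecMul_smul]
    change 0 - _ • Matrix.vecMul _ (Phi 2 _) = 0
    rw [b]; simp
  · intro x
    have a := left _ _ (hpos _ (hp x)).isHermitian (k2 x)
    have b := left _ _ (Phi_herm x) (Phi_ker' x)
    rw [star_star] at a b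
    simp only [LinearMap.sub_apply, LinearMap.smul_apply, Matrix.vecMul_sub, a,
      Matrix.vecMul_smul]
    change 0 - _ • Matrix.vecMul _ (Phi 2 _) = 0
    rw [b]; simp
  · simp only [LinearMap.sub_apply, LinearMap.smul_apply, Matrix.sub_apply, Matrix.smul_apply]
    change w - _ • (Phi 2 _ _ _) = 0
    rw [hP, hwr]
    simp
    ring
end
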